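/- Let s ∈ (0,∞) and r ∈ [1,∞] with 1 ≤ 1/s + 1/r. Let A ∈ L(E1,…,En;F) be hyper-(s,r)-nuclear, let 1 ≤ m1 < ⋯ < mn be naturals, let B1 ∈ L(G1,…,G_{m1};E1), …, Bn ∈ L(G_{m_{n-1}+1},…,G_{mn};En) be continuous multilinear operators and t ∈ L(F;H0) a continuous linear operator. Then t∘A∘(B1,…,Bn) : (x1,…,x_{mn}) ↦ t(A(B1(x1,…,x_{m1}),…,Bn(x_{m_{n-1}+1},…,x_{mn}))) is a hyper-(s,r)-nuclear m_n-linear operator and ‖t∘A∘(B1,…,Bn)‖_{HN(s,r)} ≤ ‖t‖·‖A‖_{HN(s,r)}·‖B1‖⋯‖Bn‖. -/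

import Mathlib

open Filter Topology
open scoped ENNReal NNReal BigOperators

noncomputable section

/-- The type of classes of continuous multilinear operators between Banach spaces:
one set of continuous `n`-linear operators for each `n` and each tuple of Banach spaces
`E₁, …, Eₙ, F` over `𝕜`. -/
abbrev MultiClass (𝕜 : Type) [RCLike 𝕜] : Type 1 :=
  ∀ (n : ℕ) (E : Fin n → Type) [∀ i, NormedAddCommGroup (E i)] [∀ i, NormedSpace 𝕜 (E i)]
    [∀ i, CompleteSpace (E i)]
    (F : Type) [NormedAddCommGroup F] [NormedSpace 𝕜 F] [CompleteSpace F],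
    Set (ContinuousMultilinearMap 𝕜 E F)

/-- A real-valued "norm" function defined on all continuous multilinear operators
between Banach spaces. -/
abbrev MultiNorm (𝕜 : Type) [RCLike 𝕜] : Type 1 :=
  ∀ (n : ℕ) (E : Fin n → Type) [∀ i, NormedAddCommGroup (E i)] [∀ i, NormedSpace 𝕜 (E i)]
    [∀ i, CompleteSpace (E i)]
    (F : Type) [NormedAddCommGroup F] [NormedSpace 𝕜 F] [CompleteSpace F],
    ContinuousMultilinearMap 𝕜 E F → ℝ

variable (𝕜 : Type) [RCLike 𝕜]

/-- The finite type multilinear operators: the linear span of the operators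
`(x₁,…,xₙ) ↦ φ₁(x₁)⋯φₙ(xₙ) • y` with `φᵢ ∈ Eᵢ'`, `y ∈ F`. -/
def IsFiniteType {n : ℕ} {E : Fin n → Type} [∀ i, NormedAddCommGroup (E i)]
    [∀ i, NormedSpace 𝕜 (E i)] {F : Type} [NormedAddCommGroup F] [NormedSpace 𝕜 F]
    (A : ContinuousMultilinearMap 𝕜 E F) : Prop :=
  A ∈ Submodule.span 𝕜 {B : ContinuousMultilinearMap 𝕜 E F |
      ∃ (φ : ∀ i, E i →L[𝕜] 𝕜) (y : F), ∀ x, B x = (∏ i, φ i (x i)) • y}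

/-- A multilinear operator has finite rank if its range spans a finite-dimensional
subspace of the target space. -/
def IsFiniteRank {n : ℕ} {E : Fin n → Type} [∀ i, NormedAddCommGroup (E i)]
    [∀ i, NormedSpace 𝕜 (E i)] {F : Type} [NormedAddCommGroup F] [NormedSpace 𝕜 F]
    (A : ContinuousMultilinearMap 𝕜 E F) : Prop :=
  FiniteDimensional 𝕜 (Submodule.span 𝕜 (Set.range (⇑A)))

/-- `IsBlockComp 𝕜 f B A t C` says that `C = t ∘ A ∘ (B₁,…,Bₙ)`, where the blocks of
variables `(G₁,…,G_{m₁}), (G_{m₁+1},…,G_{m₂}), …` are the fibers of the monotone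
surjection `f : Fin M → Fin n` (this encodes naturals `1 ≤ m₁ < ⋯ < mₙ = M`). -/
def IsBlockComp {n M : ℕ} {G : Fin M → Type} [∀ j, NormedAddCommGroup (G j)]
    [∀ j, NormedSpace 𝕜 (G j)] {E : Fin n → Type} [∀ i, NormedAddCommGroup (E i)]
    [∀ i, NormedSpace 𝕜 (E i)] {F H0 : Type} [NormedAddCommGroup F] [NormedSpace 𝕜 F]
    [NormedAddCommGroup H0] [NormedSpace 𝕜 H0]
    (f : Fin M → Fin n)
    (B : ∀ i : Fin n, ContinuousMultilinearMap 𝕜 (fun j : {j : Fin M // f j = i} => G j.1) (E i))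
    (A : ContinuousMultilinearMap 𝕜 E F) (t : F →L[𝕜] H0)
    (C : ContinuousMultilinearMap 𝕜 G H0) : Prop :=
  ∀ x : ∀ j, G j, C x = t (A fun i => B i fun j => x j.1)

/-- `(λ_j)_j ∈ ℓ_s`. -/
def MemLs (s : ℝ) (lam : ℕ → 𝕜) : Prop := Summable fun j => ‖lam j‖ ^ s

/-- The `ℓ_s`-norm of a scalar sequence. -/
def lsNorm (s : ℝ) (lam : ℕ → 𝕜) : ℝ := (∑' j, ‖lam j‖ ^ s) ^ (1 / s)

/-- A bounded sequence. -/
def BddSeq {X : Type} [NormedAddCommGroup X] (T : ℕ → X) : Prop := ∃ c, ∀ j, ‖T j‖ ≤ c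

/-- `(T_j)_j` is weakly `r`-summable in `X`; for `r = ∞` this means bounded. -/
def WeaklySummable (r : ℝ≥0∞) {X : Type} [NormedAddCommGroup X] [NormedSpace 𝕜 X]
    (T : ℕ → X) : Prop :=
  if r = ⊤ then BddSeq T
  else ∀ φ : X →L[𝕜] 𝕜, Summable fun j => ‖φ (T j)‖ ^ r.toReal

/-- The `ℓ_r`-norm of a sequence of reals (`r = ∞` gives the sup). -/
def seqLrNorm (r : ℝ≥0∞) (a : ℕ → ℝ) : ℝ :=
  if r = ⊤ then ⨆ j, |a j| else (∑' j, |a j| ^ r.toReal) ^ (1 / r.toReal)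

/-- The weak `ℓ_r`-norm `‖(T_j)_j‖_{w,r} = sup_{‖φ‖ ≤ 1} ‖(φ(T_j))_j‖_r`. -/
def weakNorm (r : ℝ≥0∞) {X : Type} [NormedAddCommGroup X] [NormedSpace 𝕜 X]
    (T : ℕ → X) : ℝ :=
  ⨆ φ : {φ : X →L[𝕜] 𝕜 // ‖φ‖ ≤ 1}, seqLrNorm r fun j => ‖(φ : X →L[𝕜] 𝕜) (T j)‖

/-- `(lam, T, y)` is a hyper-`(s,r)`-nuclear representation of `A`, i.e. `lam ∈ ℓ_s`,
`T` is a weakly `r`-summable sequence of `n`-linear forms, `y` is a bounded sequence and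
`A(x) = ∑_j lam_j T_j(x) • y_j`. -/
def IsHyperNuclearRep {n : ℕ} {E : Fin n → Type} [∀ i, NormedAddCommGroup (E i)]
    [∀ i, NormedSpace 𝕜 (E i)] {F : Type} [NormedAddCommGroup F] [NormedSpace 𝕜 F]
    (s : ℝ) (r : ℝ≥0∞) (lam : ℕ → 𝕜) (T : ℕ → ContinuousMultilinearMap 𝕜 E 𝕜)
    (y : ℕ → F) (A : ContinuousMultilinearMap 𝕜 E F) : Prop :=
  MemLs 𝕜 s lam ∧ WeaklySummable 𝕜 r T ∧ BddSeq y ∧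
    ∀ x, HasSum (fun j => (lam j * T j x) • y j) (A x)

/-- Hyper-`(s,r)`-nuclear multilinear operators (`s = 1`, `r = ∞` gives the
hyper-nuclear operators). -/
def IsHyperNuclear {n : ℕ} {E : Fin n → Type} [∀ i, NormedAddCommGroup (E i)]
    [∀ i, NormedSpace 𝕜 (E i)] {F : Type} [NormedAddCommGroup F] [NormedSpace 𝕜 F]
    (s : ℝ) (r : ℝ≥0∞) (A : ContinuousMultilinearMap 𝕜 E F) : Prop :=
  ∃ lam T y, IsHyperNuclearRep 𝕜 s r lam T y A

/-- The hyper-`(s,r)`-nuclear norm. -/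
def hnNorm {n : ℕ} {E : Fin n → Type} [∀ i, NormedAddCommGroup (E i)]
    [∀ i, NormedSpace 𝕜 (E i)] {F : Type} [NormedAddCommGroup F] [NormedSpace 𝕜 F]
    (s : ℝ) (r : ℝ≥0∞) (A : ContinuousMultilinearMap 𝕜 E F) : ℝ :=
  sInf {c : ℝ | ∃ lam T y, IsHyperNuclearRep 𝕜 s r lam T y A ∧
    c = lsNorm 𝕜 s lam * weakNorm 𝕜 r T * ⨆ j, ‖y j‖}

/-- The composition `T ∘ (B₁, …, Bₙ)` of a continuous multilinear map with continuous multilinear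
maps in the blocks of variables given by the fibers of `f`. -/
def ContinuousMultilinearMap.blockComp {𝕜 : Type} [RCLike 𝕜] {n M : ℕ} {G : Fin M → Type}
    [∀ j, NormedAddCommGroup (G j)] [∀ j, NormedSpace 𝕜 (G j)] {E : Fin n → Type}
    [∀ i, NormedAddCommGroup (E i)] [∀ i, NormedSpace 𝕜 (E i)] {F : Type}
    [NormedAddCommGroup F] [NormedSpace 𝕜 F] (f : Fin M → Fin n)
    (T : ContinuousMultilinearMap 𝕜 E F)
    (B : ∀ i : Fin n,
      ContinuousMultilinearMap 𝕜 (fun j : {j : Fin M // f j = i} => G j.1) (E i)) :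
    ContinuousMultilinearMap 𝕜 G F :=
  have update_eq : ∀ [DecidableEq (Fin M)] (x : ∀ j, G j) (j : Fin M) (v : G j),
      (fun i => B i fun k => Function.update x j v k.1) =
        Function.update (fun i => B i fun k => x k.1) (f j)
          (B (f j) (Function.update (fun k : {k : Fin M // f k = f j} => x k.1) ⟨j, rfl⟩ v)) := by
    intro _ x j v
    funext i
    by_cases hi : i = f j
    · subst hi
      rw [Function.update_self]
      congr 1
      funext k
      by_cases hk : k = ⟨j, rfl⟩
      · subst hk
        simp
      · rw [Function.update_of_ne hk, Function.update_of_ne fun h => hk (Subtype.ext h)]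
    · rw [Function.update_of_ne hi]
      congr 1
      funext k
      rw [Function.update_of_ne]
      intro h
      exact hi (by rw [← k.2, h])
  { toFun := fun x => T fun i => B i fun j => x j.1
    map_update_add' := by
      intro _ x j u v
      simp only [update_eq, ContinuousMultilinearMap.map_update_add]
    map_update_smul' := by
      intro _ x j c v
      simp only [update_eq, ContinuousMultilinearMap.map_update_smul]
    cont := T.cont.comp <| continuous_pi fun i =>
      (B i).cont.comp <| continuous_pi fun j => continuous_apply j.1 }

theorem ContinuousMultilinearMap.norm_blockComp_le {𝕜 : Type} [RCLike 𝕜] {n M : ℕ}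
    {G : Fin M → Type} [∀ j, NormedAddCommGroup (G j)] [∀ j, NormedSpace 𝕜 (G j)]
    {E : Fin n → Type} [∀ i, NormedAddCommGroup (E i)] [∀ i, NormedSpace 𝕜 (E i)] {F : Type}
    [NormedAddCommGroup F] [NormedSpace 𝕜 F] (f : Fin M → Fin n)
    (T : ContinuousMultilinearMap 𝕜 E F)
    (B : ∀ i : Fin n,
      ContinuousMultilinearMap 𝕜 (fun j : {j : Fin M // f j = i} => G j.1) (E i)) :
    ‖T.blockComp f B‖ ≤ (∏ i, ‖B i‖) * ‖T‖ := by
  refine ContinuousMultilinearMap.opNorm_le_bound (by positivity) fun x => ?_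
  calc ‖T fun i => B i fun j => x j.1‖
      ≤ ‖T‖ * ∏ i, ‖B i fun j => x j.1‖ := T.le_opNorm _
    _ ≤ ‖T‖ * ∏ i, (‖B i‖ * ∏ j : {j : Fin M // f j = i}, ‖x j.1‖) := by
        gcongr with i
        exact (B i).le_opNorm _
    _ = (∏ i, ‖B i‖) * ‖T‖ * ∏ j, ‖x j‖ := by
        rw [Finset.prod_mul_distrib, Fintype.prod_fiberwise f fun j => ‖x j‖]
        ring

/-- The linear map `T ↦ T ∘ (B₁, …, Bₙ)`. -/
def ContinuousMultilinearMap.blockCompL {𝕜 : Type} [RCLike 𝕜] {n M : ℕ} {G : Fin M → Type}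
    [∀ j, NormedAddCommGroup (G j)] [∀ j, NormedSpace 𝕜 (G j)] {E : Fin n → Type}
    [∀ i, NormedAddCommGroup (E i)] [∀ i, NormedSpace 𝕜 (E i)] (F : Type)
    [NormedAddCommGroup F] [NormedSpace 𝕜 F] (f : Fin M → Fin n)
    (B : ∀ i : Fin n,
      ContinuousMultilinearMap 𝕜 (fun j : {j : Fin M // f j = i} => G j.1) (E i)) :
    ContinuousMultilinearMap 𝕜 E F →L[𝕜] ContinuousMultilinearMap 𝕜 G F :=
  LinearMap.mkContinuous
    { toFun := fun T => T.blockComp f B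
      map_add' := fun _ _ => rfl
      map_smul' := fun _ _ => rfl }
    (∏ i, ‖B i‖) fun T => T.norm_blockComp_le f B

theorem ContinuousMultilinearMap.norm_blockCompL_le {𝕜 : Type} [RCLike 𝕜] {n M : ℕ}
    {G : Fin M → Type} [∀ j, NormedAddCommGroup (G j)] [∀ j, NormedSpace 𝕜 (G j)]
    {E : Fin n → Type} [∀ i, NormedAddCommGroup (E i)] [∀ i, NormedSpace 𝕜 (E i)] (F : Type)
    [NormedAddCommGroup F] [NormedSpace 𝕜 F] (f : Fin M → Fin n)
    (B : ∀ i : Fin n,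
      ContinuousMultilinearMap 𝕜 (fun j : {j : Fin M // f j = i} => G j.1) (E i)) :
    ‖blockCompL F f B‖ ≤ ∏ i, ‖B i‖ :=
  LinearMap.mkContinuous_norm_le _ (by positivity) _

theorem seqLrNorm_nonneg (r : ℝ≥0∞) (a : ℕ → ℝ) : 0 ≤ seqLrNorm r a := by
  unfold seqLrNorm
  split_ifs
  · exact Real.iSup_nonneg fun j => abs_nonneg _
  · exact Real.rpow_nonneg (tsum_nonneg fun j => by positivity) _

theorem seqLrNorm_const_mul {r : ℝ≥0∞} (hr : 1 ≤ r) {k : ℝ} (hk : 0 ≤ k) (a : ℕ → ℝ) :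
    seqLrNorm r (fun j => k * a j) = k * seqLrNorm r a := by
  unfold seqLrNorm
  split_ifs with h
  · simp only [abs_mul, abs_of_nonneg hk]
    rw [Real.mul_iSup_of_nonneg hk]
  · have hp : 0 < r.toReal := ENNReal.toReal_pos (by positivity) h
    simp only [abs_mul, abs_of_nonneg hk, Real.mul_rpow hk (abs_nonneg _)]
    rw [tsum_mul_left, Real.mul_rpow (by positivity) (tsum_nonneg fun j => by positivity),
      ← Real.rpow_mul hk, mul_one_div_cancel hp.ne', Real.rpow_one]

theorem weakNorm_nonneg (r : ℝ≥0∞) {X : Type} [NormedAddCommGroup X] [NormedSpace 𝕜 X]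
    (T : ℕ → X) : 0 ≤ weakNorm 𝕜 r T :=
  Real.iSup_nonneg fun _ => seqLrNorm_nonneg _ _

variable {𝕜}

/-- By the uniform boundedness principle, the weak norm of a weakly summable sequence is finite. -/
theorem WeaklySummable.bddAbove {r : ℝ≥0∞} (hr : 1 ≤ r) {X : Type} [NormedAddCommGroup X]
    [NormedSpace 𝕜 X] {T : ℕ → X} (hT : WeaklySummable 𝕜 r T) :
    BddAbove (Set.range fun φ : {φ : X →L[𝕜] 𝕜 // ‖φ‖ ≤ 1} =>
      seqLrNorm r fun j => ‖(φ : X →L[𝕜] 𝕜) (T j)‖) := by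
  unfold WeaklySummable at hT
  split_ifs at hT with h
  · obtain ⟨c, hc⟩ := hT
    refine ⟨c, ?_⟩
    rintro _ ⟨φ, rfl⟩
    simp only [seqLrNorm, if_pos h, abs_norm]
    exact ciSup_le fun j => (φ.1.le_of_opNorm_le φ.2 _).trans (by simpa using hc j)
  · have : Fact (1 ≤ r) := ⟨hr⟩
    have hp : 0 < r.toReal := ENNReal.toReal_pos (by positivity) h
    let S : ℕ → (X →L[𝕜] 𝕜) →L[𝕜] lp (fun _ : ℕ => 𝕜) r := fun N =>
      ∑ j ∈ Finset.range N, lp.singleContinuousLinearMap 𝕜 (fun _ : ℕ => 𝕜) r j ∘L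
        ContinuousLinearMap.apply 𝕜 𝕜 (T j)
    have hS : ∀ N φ, ‖S N φ‖ =
        (∑ j ∈ Finset.range N, ‖φ (T j)‖ ^ r.toReal) ^ (1 / r.toReal) := by
      intro N φ
      rw [← lp.norm_sum_single hp (fun j => φ (T j)), ← Real.rpow_mul (norm_nonneg _),
        mul_one_div_cancel hp.ne', Real.rpow_one]
      simp [S]
    obtain ⟨K, hK⟩ := banach_steinhaus (g := S) fun φ =>
      ⟨(∑' j, ‖φ (T j)‖ ^ r.toReal) ^ (1 / r.toReal), fun N => by
        rw [hS]
        exact Real.rpow_le_rpow (by positivity)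
          ((hT φ).sum_le_tsum _ fun j _ => by positivity) (by positivity)⟩
    have hK0 : 0 ≤ K := (norm_nonneg _).trans (hK 0)
    refine ⟨K, ?_⟩
    rintro _ ⟨φ, rfl⟩
    simp only [seqLrNorm, if_neg h, abs_norm]
    rw [one_div, Real.rpow_inv_le_iff_of_pos (tsum_nonneg fun j => by positivity) hK0 hp]
    refine Real.tsum_le_of_sum_range_le (fun j => by positivity) fun N => ?_
    rw [← Real.rpow_inv_le_iff_of_pos (by positivity) hK0 hp, ← one_div, ← hS]
    exact ((S N).le_of_opNorm_le (hK N) _).trans (mul_le_of_le_one_right hK0 φ.2)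

theorem WeaklySummable.map {r : ℝ≥0∞} {X Y : Type} [NormedAddCommGroup X] [NormedSpace 𝕜 X]
    [NormedAddCommGroup Y] [NormedSpace 𝕜 Y] {T : ℕ → X} (hT : WeaklySummable 𝕜 r T)
    (u : X →L[𝕜] Y) : WeaklySummable 𝕜 r fun j => u (T j) := by
  unfold WeaklySummable at *
  split_ifs at * with h
  · obtain ⟨c, hc⟩ := hT
    exact ⟨‖u‖ * c, fun j => u.le_opNorm_of_le (hc j)⟩
  · exact fun φ => hT (φ ∘L u)

theorem WeaklySummable.weakNorm_map_le {r : ℝ≥0∞} (hr : 1 ≤ r) {X Y : Type}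
    [NormedAddCommGroup X] [NormedSpace 𝕜 X] [NormedAddCommGroup Y] [NormedSpace 𝕜 Y]
    {T : ℕ → X} (hT : WeaklySummable 𝕜 r T) (u : X →L[𝕜] Y) :
    weakNorm 𝕜 r (fun j => u (T j)) ≤ ‖u‖ * weakNorm 𝕜 r T := by
  refine Real.iSup_le (fun φ => ?_) (mul_nonneg (norm_nonneg _) (weakNorm_nonneg 𝕜 r T))
  have hφu : ‖φ.1 ∘L u‖ ≤ ‖u‖ :=
    (φ.1.opNorm_comp_le u).trans (mul_le_of_le_one_left (norm_nonneg _) φ.2)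
  let ψ : X →L[𝕜] 𝕜 := ((‖u‖⁻¹ : ℝ) : 𝕜) • (φ.1 ∘L u)
  have hψ : ‖ψ‖ ≤ 1 := by
    rw [norm_smul, RCLike.norm_ofReal, abs_of_nonneg (by positivity)]
    exact inv_mul_le_one_of_le₀ hφu (norm_nonneg _)
  have key : (fun j => ‖φ.1 (u (T j))‖) = fun j => ‖u‖ * ‖ψ (T j)‖ := by
    funext j
    rcases (norm_nonneg u).eq_or_lt with h0 | h0
    · have : u = 0 := norm_eq_zero.mp h0.symm
      simp [this]
    · have : ‖ψ (T j)‖ = ‖u‖⁻¹ * ‖φ.1 (u (T j))‖ := by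
        change ‖((‖u‖⁻¹ : ℝ) : 𝕜) • φ.1 (u (T j))‖ = _
        rw [norm_smul, RCLike.norm_ofReal, abs_of_nonneg (by positivity)]
      rw [this, mul_inv_cancel_left₀ h0.ne']
  rw [key, seqLrNorm_const_mul hr (norm_nonneg _)]
  exact mul_le_mul_of_nonneg_left (le_ciSup (hT.bddAbove hr) ⟨ψ, hψ⟩) (norm_nonneg _)

theorem lsNorm_nonneg (s : ℝ) (lam : ℕ → 𝕜) : 0 ≤ lsNorm 𝕜 s lam :=
  Real.rpow_nonneg (tsum_nonneg fun _ => by positivity) _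

theorem BddSeq.map {X Y : Type} [NormedAddCommGroup X] [NormedSpace 𝕜 X]
    [NormedAddCommGroup Y] [NormedSpace 𝕜 Y] {y : ℕ → X} (hy : BddSeq y) (t : X →L[𝕜] Y) :
    BddSeq fun j => t (y j) :=
  let ⟨c, hc⟩ := hy
  ⟨‖t‖ * c, fun j => t.le_opNorm_of_le (hc j)⟩

theorem BddSeq.iSup_norm_map_le {X Y : Type} [NormedAddCommGroup X] [NormedSpace 𝕜 X]
    [NormedAddCommGroup Y] [NormedSpace 𝕜 Y] {y : ℕ → X} (hy : BddSeq y) (t : X →L[𝕜] Y) :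
    ⨆ j, ‖t (y j)‖ ≤ ‖t‖ * ⨆ j, ‖y j‖ := by
  obtain ⟨c, hc⟩ := hy
  refine ciSup_le fun j => t.le_opNorm_of_le ?_
  exact le_ciSup (f := fun j => ‖y j‖) ⟨c, Set.forall_mem_range.2 hc⟩ j

/-- A hyper-nuclear representation of `A` induces one of `t ∘ A ∘ (B₁, …, Bₙ)`. -/
theorem IsHyperNuclearRep.blockComp {s : ℝ} {r : ℝ≥0∞} {n M : ℕ} {G : Fin M → Type}
    [∀ j, NormedAddCommGroup (G j)] [∀ j, NormedSpace 𝕜 (G j)] {E : Fin n → Type}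
    [∀ i, NormedAddCommGroup (E i)] [∀ i, NormedSpace 𝕜 (E i)] {F H0 : Type}
    [NormedAddCommGroup F] [NormedSpace 𝕜 F] [NormedAddCommGroup H0] [NormedSpace 𝕜 H0]
    {f : Fin M → Fin n}
    {B : ∀ i : Fin n, ContinuousMultilinearMap 𝕜 (fun j : {j : Fin M // f j = i} => G j.1) (E i)}
    {A : ContinuousMultilinearMap 𝕜 E F} {t : F →L[𝕜] H0} {C : ContinuousMultilinearMap 𝕜 G H0}
    (hC : IsBlockComp 𝕜 f B A t C) {lam : ℕ → 𝕜} {T : ℕ → ContinuousMultilinearMap 𝕜 E 𝕜}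
    {y : ℕ → F} (h : IsHyperNuclearRep 𝕜 s r lam T y A) :
    IsHyperNuclearRep 𝕜 s r lam (fun j => ContinuousMultilinearMap.blockCompL 𝕜 f B (T j))
      (fun j => t (y j)) C := by
  obtain ⟨hlam, hT, hy, hsum⟩ := h
  refine ⟨hlam, hT.map _, hy.map t, fun x => ?_⟩
  rw [hC x]
  convert t.hasSum (hsum fun i => B i fun j => x j.1) using 2 with j
  rw [map_smul]
  rfl

variable (𝕜)

/-- Hyper-`(s,r)`-nuclear operators have the hyper-ideal property, together with the
hyper-ideal norm inequality. -/
theorem hyperNuclear_blockComp (s : ℝ) (r : ℝ≥0∞) (hs : 0 < s) (hr : 1 ≤ r)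
    (hsr : 1 ≤ 1 / s + (r⁻¹).toReal)
    {n M : ℕ} {G : Fin M → Type} [∀ j, NormedAddCommGroup (G j)]
    [∀ j, NormedSpace 𝕜 (G j)] [∀ j, CompleteSpace (G j)]
    {E : Fin n → Type} [∀ i, NormedAddCommGroup (E i)] [∀ i, NormedSpace 𝕜 (E i)]
    [∀ i, CompleteSpace (E i)]
    {F H0 : Type} [NormedAddCommGroup F] [NormedSpace 𝕜 F] [CompleteSpace F]
    [NormedAddCommGroup H0] [NormedSpace 𝕜 H0] [CompleteSpace H0]
    (f : Fin M → Fin n) (hmono : Monotone f) (hsurj : Function.Surjective f)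
    (B : ∀ i : Fin n, ContinuousMultilinearMap 𝕜 (fun j : {j : Fin M // f j = i} => G j.1) (E i))
    (A : ContinuousMultilinearMap 𝕜 E F) (hA : IsHyperNuclear 𝕜 s r A)
    (t : F →L[𝕜] H0) (C : ContinuousMultilinearMap 𝕜 G H0)
    (hC : IsBlockComp 𝕜 f B A t C) :
    IsHyperNuclear 𝕜 s r C ∧
      hnNorm 𝕜 s r C ≤ ‖t‖ * hnNorm 𝕜 s r A * ∏ i, ‖B i‖ := by
  have hbdd : BddBelow {c : ℝ | ∃ lam T y, IsHyperNuclearRep 𝕜 s r lam T y C ∧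
      c = lsNorm 𝕜 s lam * weakNorm 𝕜 r T * ⨆ j, ‖y j‖} := by
    refine ⟨0, ?_⟩
    rintro _ ⟨lam, T, y, -, rfl⟩
    exact mul_nonneg (mul_nonneg (lsNorm_nonneg s lam) (weakNorm_nonneg 𝕜 r T))
      (Real.iSup_nonneg fun j => norm_nonneg _)
  have key : ∀ lam T y, IsHyperNuclearRep 𝕜 s r lam T y A →
      hnNorm 𝕜 s r C ≤
        (‖t‖ * ∏ i, ‖B i‖) * (lsNorm 𝕜 s lam * weakNorm 𝕜 r T * ⨆ j, ‖y j‖) := by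
    intro lam T y h
    have hW : weakNorm 𝕜 r (fun j => ContinuousMultilinearMap.blockCompL 𝕜 f B (T j)) ≤
        (∏ i, ‖B i‖) * weakNorm 𝕜 r T :=
      (h.2.1.weakNorm_map_le hr _).trans (mul_le_mul_of_nonneg_right
        (ContinuousMultilinearMap.norm_blockCompL_le 𝕜 f B) (weakNorm_nonneg 𝕜 r T))
    calc hnNorm 𝕜 s r C
        ≤ lsNorm 𝕜 s lam *
            weakNorm 𝕜 r (fun j => ContinuousMultilinearMap.blockCompL 𝕜 f B (T j)) *
            ⨆ j, ‖t (y j)‖ := csInf_le hbdd ⟨_, _, _, h.blockComp hC, rfl⟩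
      _ ≤ lsNorm 𝕜 s lam * ((∏ i, ‖B i‖) * weakNorm 𝕜 r T) * (‖t‖ * ⨆ j, ‖y j‖) :=
          mul_le_mul (mul_le_mul_of_nonneg_left hW (lsNorm_nonneg s lam))
            (h.2.2.1.iSup_norm_map_le t) (Real.iSup_nonneg fun j => norm_nonneg _)
            (mul_nonneg (lsNorm_nonneg s lam)
              (mul_nonneg (by positivity) (weakNorm_nonneg 𝕜 r T)))
      _ = _ := by ring
  obtain ⟨lam, T, y, h⟩ := hA
  refine ⟨⟨_, _, _, h.blockComp hC⟩, ?_⟩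
  rw [mul_right_comm]
  have hk : 0 ≤ ‖t‖ * ∏ i, ‖B i‖ := by positivity
  rcases hk.eq_or_lt with hk | hk
  · simpa [← hk] using key lam T y h
  · rw [← div_le_iff₀' hk]
    refine le_csInf ⟨_, lam, T, y, h, rfl⟩ ?_
    rintro _ ⟨lam', T', y', h', rfl⟩
    rw [div_le_iff₀' hk]
    exact key lam' T' y' h'

end
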